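/- (Euler, criticality: a fitting simplex is tight when tr A = 1.) Let A be a symmetric positive definite linear map on ℝⁿ with tr A = 1, n ≥ 1. Suppose v : Fin (n+1) → ℝⁿ satisfies ‖A (v i)‖ ≤ 1 for all i and the closed unit ball is contained in the convex hull of {v_1, …, v_{n+1}}. Then the simplex fits tightly: for every i, ‖A (v i)‖ = 1 (each vertex lies on the outer ellipsoid), and for every j ≠ i, ⟪v_j, A (v i)⟫ = -1 (so the hyperface opposite to vertex v_i lies in the hyperplane {q : ⟪q, -A v_i⟫ = 1}, which is tangent to the unit sphere at the point -A v_i). -/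

import Mathlib

open scoped RealInnerProductSpace

/-- A linear functional that is bounded below by `-c` on the closed unit ball is represented by a
vector of norm at most `c`. -/
theorem norm_le_of_forall_norm_le_one {E : Type*} [NormedAddCommGroup E] [InnerProductSpace ℝ E]
    {g : E} {c : ℝ} (h : ∀ x : E, ‖x‖ ≤ 1 → 0 ≤ c + ⟪g, x⟫) : ‖g‖ ≤ c := by
  rcases eq_or_ne g 0 with rfl | hg
  · simpa using h 0 (by simp)
  have hg' : ‖g‖ ≠ 0 := norm_ne_zero_iff.2 hg
  have := h (-(‖g‖⁻¹ • g)) (by rw [norm_neg, norm_smul, norm_inv, norm_norm, inv_mul_cancel₀ hg'])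
  rw [inner_neg_right, inner_smul_right, real_inner_self_eq_norm_sq, sq,
    inv_mul_cancel_left₀ hg'] at this
  linarith

/-- The equality case of `⟪g, w⟫ ≤ c` for `‖g‖ ≤ c` and `‖w‖ ≤ 1`. -/
theorem eq_smul_of_inner_eq {E : Type*} [NormedAddCommGroup E] [InnerProductSpace ℝ E]
    {g w : E} {c : ℝ} (hg : ‖g‖ ≤ c) (hw : ‖w‖ ≤ 1) (h : ⟪g, w⟫ = c) : g = c • w := by
  have hc : 0 ≤ c := (norm_nonneg g).trans hg
  have h1 := norm_sub_sq_real g (c • w)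
  rw [inner_smul_right, h, norm_smul, Real.norm_of_nonneg hc] at h1
  have h2 : ‖g‖ ^ 2 ≤ c ^ 2 := by gcongr
  have h3 : (c * ‖w‖) ^ 2 ≤ c ^ 2 := by
    gcongr
    exact mul_le_of_le_one_right hc hw
  have h4 : ‖g - c • w‖ ^ 2 = 0 := le_antisymm (by linarith [sq c]) (sq_nonneg _)
  exact sub_eq_zero.1 (norm_eq_zero.1 (pow_eq_zero_iff two_ne_zero |>.1 h4))

/-- The trace of a linear map in terms of the barycentric coordinates of an affine basis. -/
theorem AffineBasis.trace_eq_sum_coord_linear {ι k V : Type*} [Fintype ι] [Field k]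
    [AddCommGroup V] [Module k V] [FiniteDimensional k V] (b : AffineBasis ι k V) (A : V →ₗ[k] V) :
    LinearMap.trace k V A = ∑ i, (b.coord i).linear (A (b i)) := by
  have hA : A = ∑ i, (b.coord i).linear.smulRight (A (b i)) := by
    ext x
    have hx (y : V) : A y = ∑ i, b.coord i y • A (b i) := by
      conv_lhs => rw [← b.linear_combination_coord_eq_self y]
      simp only [map_sum, map_smul]
    have hl (i : ι) : (b.coord i).linear x = b.coord i x - b.coord i 0 := by
      simpa using (b.coord i).linearMap_vsub x 0
    have h0 := hx 0
    rw [map_zero] at h0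
    simp only [LinearMap.sum_apply, LinearMap.smulRight_apply, hl, sub_smul,
      Finset.sum_sub_distrib, ← h0, ← hx, sub_zero]
  conv_lhs => rw [hA]
  simp [LinearMap.trace_smulRight]

/-- `n + 1` points of an `n`-dimensional space whose convex hull contains the closed unit ball form
an affine basis. -/
theorem exists_affineBasis_of_closedBall_subset_convexHull {E ι : Type*} [NormedAddCommGroup E]
    [NormedSpace ℝ E] [FiniteDimensional ℝ E] [Fintype ι] {v : ι → E}
    (hcard : Fintype.card ι = Module.finrank ℝ E + 1)
    (hball : Metric.closedBall (0 : E) 1 ⊆ convexHull ℝ (Set.range v)) :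
    ∃ b : AffineBasis ι ℝ E, ⇑b = v := by
  have htop : affineSpan ℝ (Set.range v) = ⊤ := by
    rw [← affineSpan_convexHull, ← top_le_iff,
      ← affineSpan_eq_top_of_nonempty_interior (s := Metric.closedBall (0 : E) 1)]
    · exact affineSpan_mono ℝ hball
    · refine ⟨0, ?_⟩
      rw [(convex_closedBall (0 : E) 1).convexHull_eq]
      exact Metric.ball_subset_interior_closedBall (Metric.mem_ball_self one_pos)
  have hind : AffineIndependent ℝ v := by
    rw [affineIndependent_iff_finrank_vectorSpan_eq ℝ v hcard, ← direction_affineSpan, htop,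
      AffineSubspace.direction_top, finrank_top]
  exact ⟨⟨v, hind, htop⟩, rfl⟩

/-- Euler, criticality: if `tr A = 1`, every simplex fitting between the unit sphere and the
outer ellipsoid `E_out = {v : ‖A v‖ = 1}` fits tightly: each vertex lies on `E_out` and each
hyperface lies in a hyperplane tangent to the unit sphere. -/
theorem euler_fitting_is_tight {n : ℕ} (hn : 1 ≤ n)
    (A : EuclideanSpace ℝ (Fin n) →ₗ[ℝ] EuclideanSpace ℝ (Fin n))
    (hsym : ∀ x y, ⟪A x, y⟫ = ⟪x, A y⟫)
    (hpos : ∀ x, x ≠ 0 → 0 < ⟪A x, x⟫)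
    (htr : LinearMap.trace ℝ (EuclideanSpace ℝ (Fin n)) A = 1)
    (v : Fin (n + 1) → EuclideanSpace ℝ (Fin n))
    (hvert : ∀ i, ‖A (v i)‖ ≤ 1)
    (hball : Metric.closedBall (0 : EuclideanSpace ℝ (Fin n)) 1 ⊆
      convexHull ℝ (Set.range v)) :
    ∀ i, ‖A (v i)‖ = 1 ∧ ∀ j, j ≠ i → ⟪v j, A (v i)⟫ = -1 := by
  obtain ⟨b, rfl⟩ := exists_affineBasis_of_closedBall_subset_convexHull (by simp) hball
  rw [b.convexHull_eq_nonneg_coord] at hball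
  let c (i : Fin (n + 1)) : ℝ := b.coord i 0
  let g (i : Fin (n + 1)) : EuclideanSpace ℝ (Fin n) :=
    (InnerProductSpace.toDual ℝ _).symm (LinearMap.toContinuousLinearMap (b.coord i).linear)
  have hg (i x) : ⟪g i, x⟫ = (b.coord i).linear x := by simp [g]
  have hcoord (i x) : b.coord i x = c i + ⟪g i, x⟫ := by
    have := (b.coord i).linearMap_vsub x 0
    simp only [vsub_eq_sub, sub_zero] at this
    rw [hg, this]
    ring
  have hnorm (i) : ‖g i‖ ≤ c i := norm_le_of_forall_norm_le_one fun x hx ↦ by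
    rw [← hcoord]
    exact hball (mem_closedBall_zero_iff.2 hx) i
  have hle (i) : ⟪g i, A (b i)⟫ ≤ c i :=
    (real_inner_le_norm _ _).trans <|
      (mul_le_of_le_one_right (norm_nonneg _) (hvert i)).trans (hnorm i)
  have hsum : ∑ i, ⟪g i, A (b i)⟫ = ∑ i, c i := by
    simp_rw [hg, ← b.trace_eq_sum_coord_linear, htr, c, b.sum_coord_apply_eq_one]
  have heq (i) : ⟪g i, A (b i)⟫ = c i :=
    (Finset.sum_eq_sum_iff_of_le fun i _ ↦ hle i).1 hsum i (Finset.mem_univ i)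
  intro i
  have hgi : g i = c i • A (b i) := eq_smul_of_inner_eq (hnorm i) (hvert i) (heq i)
  have hci : c i ≠ 0 := fun h ↦ by
    have := hcoord i (b i)
    simp [hgi, h] at this
  refine ⟨?_, fun j hj ↦ ?_⟩
  · have h := heq i
    rw [hgi, real_inner_smul_left, real_inner_self_eq_norm_sq, mul_eq_left₀ hci] at h
    exact (pow_eq_one_iff_of_nonneg (norm_nonneg _) two_ne_zero).1 h
  · have h := hcoord i (b j)
    rw [b.coord_apply_ne hj.symm, hgi, real_inner_smul_left, real_inner_comm] at h
    apply mul_left_cancel₀ hci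
    linarith
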